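/- arXiv:2001.10013 — 6 statements merged into one kernel-verified Lean document; each statement's English description precedes it below -/
import Mathlib

section
/- Let x, y ∈ ℝ^n be vectors with non-negative entries and let f : [0,∞) → ℝ be a superquadratic function. If x is majorized by y (x ≺ y), then there exists a doubly stochastic n×n matrix P = [p_ij] such that x = Py and Σ_{i=1}^n f(x_i) ≤ Σ_{j=1}^n f(y_j) − Σ_{i=1}^n Σ_{j=1}^n p_ij · f(|x_i − y_j|). -/
open Matrix

/-- A function `f` is superquadratic on `[0,∞)` if for every `s ≥ 0` there is a constant
`C_s ∈ ℝ` with `f t ≥ f s + C_s (t - s) + f |t - s|` for all `t ≥ 0`. -/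
def Superquadratic (f : ℝ → ℝ) : Prop :=
  ∀ s : ℝ, 0 ≤ s → ∃ C : ℝ, ∀ t : ℝ, 0 ≤ t → f s + C * (t - s) + f |t - s| ≤ f t

/-- `x` is majorized by `y`:  every partial sum of the decreasing rearrangement of `x`
(equivalently, every sum of `k` entries of `x`) is dominated by the corresponding largest sum
of `k` entries of `y`, and the total sums coincide. -/
def Majorizes {n : ℕ} (x y : Fin n → ℝ) : Prop :=
  (∀ S : Finset (Fin n), ∃ T : Finset (Fin n), T.card = S.card ∧ ∑ i ∈ S, x i ≤ ∑ j ∈ T, y j) ∧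
    ∑ i, x i = ∑ i, y i

/-- A real square matrix is doubly stochastic if its entries are non-negative and all row sums
and column sums equal one. -/
def IsDoublyStochastic {n : ℕ} (P : Matrix (Fin n) (Fin n) ℝ) : Prop :=
  (∀ i j, 0 ≤ P i j) ∧ (∀ i, ∑ j, P i j = 1) ∧ (∀ j, ∑ i, P i j = 1)

/-- Among all sets of a given cardinality, an initial segment minimizes the sum of a monotone
function. -/
lemma sum_filter_val_lt_le_sum {n k : ℕ} {w : Fin n → ℝ} (hw : Monotone w)
    {U : Finset (Fin n)} (hU : U.card = (Finset.univ.filter fun i : Fin n => i.val < k).card) :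
    ∑ i with i.val < k, w i ≤ ∑ i ∈ U, w i := by
  set A := Finset.univ.filter fun i : Fin n => i.val < k with hA
  rcases le_or_gt n k with hk | hk
  · have hAu : A = Finset.univ := by
      ext i
      simpa [hA] using i.isLt.trans_le hk
    rw [hAu, (Finset.card_eq_iff_eq_univ U).1 (by rw [hU, hAu, Finset.card_univ])]
  · have hcard : (A \ U).card = (U \ A).card := by
      have h₁ := Finset.card_sdiff_add_card_inter A U
      have h₂ := Finset.card_sdiff_add_card_inter U A
      rw [Finset.inter_comm] at h₂
      omega
    have hlow : ∑ i ∈ A \ U, w i ≤ (A \ U).card • w ⟨k, hk⟩ :=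
      Finset.sum_le_card_nsmul _ _ _ fun i hi => hw <| by
        simp only [hA, Finset.mem_sdiff, Finset.mem_filter] at hi
        exact Fin.le_def.2 hi.1.2.le
    have hhigh : (U \ A).card • w ⟨k, hk⟩ ≤ ∑ i ∈ U \ A, w i :=
      Finset.card_nsmul_le_sum _ _ _ fun i hi => hw <| by
        simp only [hA, Finset.mem_sdiff, Finset.mem_filter, Finset.mem_univ, true_and,
          not_lt] at hi
        exact Fin.le_def.2 hi.2
    rw [← Finset.sum_inter_add_sum_sdiff A U, ← Finset.sum_inter_add_sum_sdiff U A,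
      Finset.inter_comm U A]
    rw [hcard] at hlow
    linarith

/-- Abel summation: a sequence with non-negative partial sums, weighted by a monotone sequence. -/
lemma sum_range_succ_mul_le {m : ℕ} {c d : ℕ → ℝ} (hc : ∀ i < m, c i ≤ c (i + 1))
    (hd : ∀ k ≤ m, 0 ≤ ∑ i ∈ Finset.range k, d i) :
    ∑ i ∈ Finset.range (m + 1), c i * d i ≤ c m * ∑ i ∈ Finset.range (m + 1), d i := by
  induction m with
  | zero => simp
  | succ m ih =>
    have h := ih (fun i hi => hc i (by omega)) (fun k hk => hd k (by omega))
    rw [Finset.sum_range_succ, Finset.sum_range_succ d]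
    nlinarith [mul_le_mul_of_nonneg_right (hc m (by omega)) (hd (m + 1) le_rfl)]

lemma sum_mul_nonpos_of_monotone {n : ℕ} {c d : Fin n → ℝ} (hc : Monotone c)
    (hd : ∀ k : ℕ, 0 ≤ ∑ i with i.val < k, d i) (hsum : ∑ i, d i = 0) :
    ∑ i, c i * d i ≤ 0 := by
  rcases n with _ | m
  · simp
  let c' : ℕ → ℝ := fun i => if h : i < m + 1 then c ⟨i, h⟩ else 0
  let d' : ℕ → ℝ := fun i => if h : i < m + 1 then d ⟨i, h⟩ else 0
  have hpartial (k : ℕ) (hk : k ≤ m + 1) :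
      ∑ i ∈ Finset.range k, d' i = ∑ i : Fin (m + 1) with i.val < k, d i := by
    rw [Finset.sum_filter, Finset.sum_fin_eq_sum_range, ← Finset.sum_subset
      (Finset.range_subset_range.2 hk)]
    · refine Finset.sum_congr rfl fun i hi => ?_
      simp [d', Finset.mem_range.1 hi]
    · intro i _ hi
      simp [Finset.mem_range.not.1 hi]
  have h := sum_range_succ_mul_le (m := m) (c := c') (d := d')
    (fun i hi => by
      simp only [c', show i < m + 1 by omega, show i + 1 < m + 1 by omega, dif_pos]
      exact hc (Fin.le_def.2 (Nat.le_succ i)))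
    (fun k hk => by rw [hpartial k (by omega)]; exact hd k)
  have hzero : ∑ i ∈ Finset.range (m + 1), d' i = 0 := by
    rw [← hsum, Finset.sum_fin_eq_sum_range]
  rw [hzero, mul_zero] at h
  rw [Finset.sum_fin_eq_sum_range]
  refine le_of_eq_of_le (Finset.sum_congr rfl fun i hi => ?_) h
  simp only [c', d', Finset.mem_range.1 hi, dif_pos]

lemma Majorizes.exists_perm_sum_mul_le {n : ℕ} {x y : Fin n → ℝ} (hxy : Majorizes x y)
    (c : Fin n → ℝ) : ∃ σ : Equiv.Perm (Fin n), ∑ i, c i * x i ≤ ∑ i, c i * y (σ i) := by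
  let τ := Tuple.sort c
  let ρ := Tuple.sort y
  refine ⟨τ.symm.trans ρ, ?_⟩
  have h := sum_mul_nonpos_of_monotone (c := c ∘ τ) (d := fun i => x (τ i) - y (ρ i))
    (Tuple.monotone_sort c) ?_ ?_
  · simp only [mul_sub, Finset.sum_sub_distrib, Function.comp_apply] at h
    rw [← Equiv.sum_comp τ, ← Equiv.sum_comp τ (fun i => c i * y _)]
    simpa using h
  · intro k
    set A := Finset.univ.filter fun i : Fin n => i.val < k with hA
    obtain ⟨T, hT, hle⟩ := hxy.1 (A.map τ.toEmbedding)ᶜ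
    have hcard : (Tᶜ.map ρ.symm.toEmbedding).card = A.card := by
      have := Finset.card_le_univ A
      simp only [Finset.card_compl, Finset.card_map] at hT ⊢
      omega
    have h₁ := sum_filter_val_lt_le_sum (Tuple.monotone_sort y) hcard
    have hx := Finset.sum_add_sum_compl (A.map τ.toEmbedding) x
    have hy := Finset.sum_add_sum_compl T y
    simp only [Finset.sum_map, Equiv.coe_toEmbedding, Function.comp_apply] at h₁ hx
    change ∑ i ∈ A, y (ρ i) ≤ ∑ i ∈ Tᶜ, y (ρ (ρ.symm i)) at h₁
    simp only [Equiv.apply_symm_apply] at h₁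
    rw [Finset.sum_sub_distrib]
    linarith [hxy.2]
  · rw [Finset.sum_sub_distrib, Equiv.sum_comp τ x, Equiv.sum_comp ρ y, hxy.2, sub_self]

/-- Rado's theorem: a vector majorized by `y` is in the convex hull of the permutations of `y`. -/
lemma Majorizes.mem_convexHull {n : ℕ} {x y : Fin n → ℝ} (hxy : Majorizes x y) :
    x ∈ convexHull ℝ (Set.range fun σ : Equiv.Perm (Fin n) => y ∘ σ) := by
  by_contra hx
  obtain ⟨g, u, hgu, hgx⟩ := geometric_hahn_banach_closed_point (convex_convexHull ℝ _)
    ((Set.finite_range _).isCompact_convexHull ℝ).isClosed hx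
  have hg (v : Fin n → ℝ) : g v = ∑ i, g (Pi.single i 1) * v i := by
    conv_lhs => rw [pi_eq_sum_univ' v, map_sum]
    refine Finset.sum_congr rfl fun i _ => ?_
    rw [map_smul, smul_eq_mul, mul_comm]
  obtain ⟨σ, hσ⟩ := hxy.exists_perm_sum_mul_le fun i => g (Pi.single i 1)
  have h := hgu (y ∘ σ) (subset_convexHull ℝ _ ⟨σ, rfl⟩)
  rw [hg] at h hgx
  simp only [Function.comp_apply] at h
  linarith

/-- The Hardy–Littlewood–Pólya theorem. -/
lemma Majorizes.exists_isDoublyStochastic {n : ℕ} {x y : Fin n → ℝ} (hxy : Majorizes x y) :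
    ∃ P : Matrix (Fin n) (Fin n) ℝ, IsDoublyStochastic P ∧ ∀ i, x i = ∑ j, P i j * y j := by
  let L : Matrix (Fin n) (Fin n) ℝ →ₗ[ℝ] Fin n → ℝ := (Matrix.mulVecBilin ℝ ℝ).flip y
  have hsub : convexHull ℝ (Set.range fun σ : Equiv.Perm (Fin n) => y ∘ σ) ⊆
      L '' (doublyStochastic ℝ (Fin n) : Set (Matrix (Fin n) (Fin n) ℝ)) := by
    refine convexHull_min ?_ (convex_doublyStochastic.linear_image L)
    rintro _ ⟨σ, rfl⟩
    exact ⟨σ.permMatrix ℝ, permMatrix_mem_doublyStochastic, Matrix.permMatrix_mulVec _⟩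
  obtain ⟨P, hP, rfl⟩ := hsub hxy.mem_convexHull
  exact ⟨P, mem_doublyStochastic_iff_sum.1 hP, fun i => rfl⟩

/-- The Jensen inequality for superquadratic functions, with finitely many weights. -/
lemma Superquadratic.jensen {ι : Type*} [Fintype ι] {f : ℝ → ℝ} (hf : Superquadratic f)
    {p y : ι → ℝ} (hp : ∀ j, 0 ≤ p j) (hsum : ∑ j, p j = 1) (hy : ∀ j, 0 ≤ y j) :
    f (∑ j, p j * y j) + ∑ j, p j * f |(∑ k, p k * y k) - y j| ≤ ∑ j, p j * f (y j) := by
  set s := ∑ k, p k * y k with hs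
  obtain ⟨C, hC⟩ := hf s (Finset.sum_nonneg fun j _ => mul_nonneg (hp j) (hy j))
  calc f s + ∑ j, p j * f |s - y j|
      = ∑ j, p j * (f s + C * (y j - s) + f |y j - s|) := by
        have h : ∀ j, p j * (f s + C * (y j - s) + f |y j - s|) =
            p j * (f s - C * s) + C * (p j * y j) + p j * f |s - y j| := fun j => by
          rw [abs_sub_comm]; ring
        simp only [h, Finset.sum_add_distrib, ← Finset.sum_mul, ← Finset.mul_sum, hsum, ← hs]
        ring
    _ ≤ ∑ j, p j * f (y j) :=
        Finset.sum_le_sum fun j _ => mul_le_mul_of_nonneg_left (hC _ (hy j)) (hp j)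

/-- If `x, y` have non-negative entries, `f` is superquadratic and `x ≺ y`, then there is a
doubly stochastic `P` with `x = P y` and
`Σᵢ f(xᵢ) ≤ Σⱼ f(yⱼ) - Σᵢⱼ pᵢⱼ f(|xᵢ - yⱼ|)`. -/
theorem majorizes_superquadratic_trace {n : ℕ} (f : ℝ → ℝ) (hf : Superquadratic f)
    (x y : Fin n → ℝ) (hx : ∀ i, 0 ≤ x i) (hy : ∀ i, 0 ≤ y i) (hxy : Majorizes x y) :
    ∃ P : Matrix (Fin n) (Fin n) ℝ, IsDoublyStochastic P ∧ (∀ i, x i = ∑ j, P i j * y j) ∧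
      ∑ i, f (x i) ≤ ∑ j, f (y j) - ∑ i, ∑ j, P i j * f |x i - y j| := by
  obtain ⟨P, hP, hPx⟩ := hxy.exists_isDoublyStochastic
  refine ⟨P, hP, hPx, ?_⟩
  have hcol : ∑ i, ∑ j, P i j * f (y j) = ∑ j, f (y j) := by
    rw [Finset.sum_comm]
    simp only [← Finset.sum_mul, hP.2.2, one_mul]
  rw [← hcol, le_sub_iff_add_le, ← Finset.sum_add_distrib]
  refine Finset.sum_le_sum fun i _ => ?_
  rw [hPx i]
  exact hf.jensen (hP.1 i) (hP.2.1 i) hy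
end

section
/- Let f : [0,∞) → ℝ be a superquadratic function, let p_1,…,p_n ≥ 0 with Σ_{j=1}^n p_j = 1, and let y_1,…,y_n ≥ 0. Setting ȳ = Σ_{j=1}^n p_j y_j, one has f(ȳ) ≤ Σ_{j=1}^n p_j f(y_j) − Σ_{j=1}^n p_j f(|y_j − ȳ|). -/
/-- Discrete Jensen inequality for superquadratic functions: if `p₁,…,pₙ ≥ 0` sum to `1` and
`y₁,…,yₙ ≥ 0`, then `f(ȳ) ≤ Σⱼ pⱼ f(yⱼ) - Σⱼ pⱼ f(|yⱼ - ȳ|)` where `ȳ = Σⱼ pⱼ yⱼ`. -/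
theorem superquadratic_jensen {n : ℕ} (f : ℝ → ℝ) (hf : Superquadratic f)
    (p y : Fin n → ℝ) (hp : ∀ j, 0 ≤ p j) (hp1 : ∑ j, p j = 1) (hy : ∀ j, 0 ≤ y j) :
    f (∑ j, p j * y j) ≤
      ∑ j, p j * f (y j) - ∑ j, p j * f |y j - ∑ i, p i * y i| := by
  set m := ∑ j, p j * y j with hm
  obtain ⟨C, hC⟩ := hf m (Finset.sum_nonneg fun j _ => mul_nonneg (hp j) (hy j))
  have hle : ∑ j, p j * (f m + C * (y j - m) + f |y j - m|) ≤ ∑ j, p j * f (y j) :=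
    Finset.sum_le_sum fun j _ => mul_le_mul_of_nonneg_left (hC (y j) (hy j)) (hp j)
  have heq : ∑ j, p j * (f m + C * (y j - m) + f |y j - m|) =
      f m + ∑ j, p j * f |y j - m| := by
    calc ∑ j, p j * (f m + C * (y j - m) + f |y j - m|)
        = ∑ j, (p j * (f m - C * m) + C * (p j * y j) + p j * f |y j - m|) :=
          Finset.sum_congr rfl fun j _ => by ring
      _ = f m + ∑ j, p j * f |y j - m| := by
          rw [Finset.sum_add_distrib, Finset.sum_add_distrib, ← Finset.sum_mul,
            ← Finset.mul_sum, hp1, ← hm]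
          ring
  linarith
end

section
/- If f : [0,∞) → ℝ is a superquadratic function that is non-negative, then f(0) = 0, f is convex on [0,∞), and f is monotone increasing on [0,∞). -/
/-- A non-negative superquadratic function satisfies `f(0) = 0`, is convex on `[0,∞)` and is
monotone increasing on `[0,∞)`. -/
theorem superquadratic_nonneg_props (f : ℝ → ℝ) (hf : Superquadratic f)
    (hf_nonneg : ∀ t : ℝ, 0 ≤ t → 0 ≤ f t) :
    f 0 = 0 ∧ ConvexOn ℝ (Set.Ici 0) f ∧ MonotoneOn f (Set.Ici 0) := by
  have h_zero : f 0 = 0 := by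
    obtain ⟨C, hC⟩ := hf 0 le_rfl
    have h := hC 0 le_rfl
    simp only [sub_self, mul_zero, add_zero, abs_zero] at h
    linarith [hf_nonneg 0 le_rfl]
  refine ⟨h_zero, ⟨convex_Ici 0, ?_⟩, ?_⟩
  · intro x hx y hy a b ha hb hab
    rw [Set.mem_Ici] at hx hy
    simp only [smul_eq_mul]
    obtain ⟨C, hC⟩ := hf (a * x + b * y) (by positivity)
    have h_x : f (a * x + b * y) + C * (x - (a * x + b * y)) ≤ f x := by
      linarith [hC x hx, hf_nonneg _ (abs_nonneg (x - (a * x + b * y)))]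
    have h_y : f (a * x + b * y) + C * (y - (a * x + b * y)) ≤ f y := by
      linarith [hC y hy, hf_nonneg _ (abs_nonneg (y - (a * x + b * y)))]
    calc f (a * x + b * y)
        = a * (f (a * x + b * y) + C * (x - (a * x + b * y)))
          + b * (f (a * x + b * y) + C * (y - (a * x + b * y))) := by
          obtain rfl : b = 1 - a := by linarith
          ring
      _ ≤ a * f x + b * f y := by gcongr
  · intro x hx y hy hxy
    rw [Set.mem_Ici] at hx hy
    rcases hx.eq_or_lt with rfl | hx_pos
    · exact h_zero.trans_le (hf_nonneg y hy)
    obtain ⟨C, hC⟩ := hf x hx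
    have h_C : 0 ≤ C := by
      have h := hC 0 le_rfl
      rw [zero_sub, abs_neg, abs_of_pos hx_pos, h_zero] at h
      exact nonneg_of_mul_nonneg_left (by linarith [hf_nonneg x hx]) hx_pos
    linarith [hC y hy, hf_nonneg _ (abs_nonneg (y - x)), mul_nonneg h_C (sub_nonneg.2 hxy)]
end

section
/- If f : [0,∞) → ℝ is a superquadratic function that is differentiable with f(0) = f′(0) = 0, then for all s, t ≥ 0 one has f(t) ≥ f(s) + f′(s)(t − s) + f(|t − s|); that is, the constant C_s in the definition of superquadraticity can be taken to be f′(s). -/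
/-- If `f` vanishes to first order at `0` from the right, then `t ↦ f |t - s|` has derivative `0`
at `s`. -/
theorem HasDerivWithinAt.hasDerivAt_comp_abs_sub_zero {f : ℝ → ℝ}
    (h : HasDerivWithinAt f 0 (Set.Ici 0) 0) (s : ℝ) :
    HasDerivAt (fun t => f |t - s|) 0 s := by
  have hlim : Filter.Tendsto (fun t : ℝ => |t - s|) (nhds s) (nhdsWithin 0 (Set.Ici 0)) := by
    refine tendsto_nhdsWithin_iff.2 ⟨?_, Filter.Eventually.of_forall fun t => abs_nonneg (t - s)⟩
    have hcont : Continuous fun t : ℝ => |t - s| := by fun_prop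
    simpa using hcont.tendsto s
  have ho := (hasDerivWithinAt_iff_isLittleO.1 h).comp_tendsto hlim
  rw [hasDerivAt_iff_isLittleO]
  simpa [Function.comp_def, Asymptotics.isLittleO_abs_right] using ho


/-- If `f` is superquadratic, differentiable with `f(0) = f'(0) = 0`, then the constant `C_s`
in the definition of superquadraticity can be taken to be `f'(s)`:
`f t ≥ f s + f'(s)(t - s) + f(|t - s|)` for all `s, t ≥ 0`. -/
theorem superquadratic_deriv_const (f f' : ℝ → ℝ) (hf : Superquadratic f)
    (hderiv : ∀ t ∈ Set.Ici (0 : ℝ), HasDerivWithinAt f (f' t) (Set.Ici 0) t)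
    (hf0 : f 0 = 0) (hf'0 : f' 0 = 0) :
    ∀ s ∈ Set.Ici (0 : ℝ), ∀ t ∈ Set.Ici (0 : ℝ),
      f s + f' s * (t - s) + f |t - s| ≤ f t := by
  intro s hs t ht
  rcases (Set.mem_Ici.1 hs).eq_or_lt with rfl | hpos
  · simp [hf0, hf'0, abs_of_nonneg (Set.mem_Ici.1 ht)]
  obtain ⟨C, hC⟩ := hf s hs
  have hnhds : Set.Ici (0 : ℝ) ∈ nhds s := Ici_mem_nhds hpos
  have h0 := hderiv 0 Set.self_mem_Ici
  rw [hf'0] at h0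
  have hd : HasDerivAt (fun t => f t - C * (t - s) - f |t - s|) (f' s - C * 1 - 0) s :=
    (((hderiv s hs).hasDerivAt hnhds).sub (((hasDerivAt_id s).sub_const s).const_mul C)).sub
      (h0.hasDerivAt_comp_abs_sub_zero s)
  have hmin : IsLocalMin (fun t => f t - C * (t - s) - f |t - s|) s := by
    filter_upwards [hnhds] with x hx
    have hx' := hC x hx
    simp only [sub_self, abs_zero, mul_zero, hf0]
    linarith
  have hCs : f' s = C := by linarith [hmin.hasDerivAt_eq_zero hd]
  rw [hCs]
  exact hC t ht
end

section
/- For every real p ≥ 2, the power function f(t) = t^p is superquadratic on [0,∞); that is, for every s ≥ 0 there exists C_s ∈ ℝ (namely C_s = p·s^{p−1}) such that t^p ≥ s^p + C_s(t − s) + |t − s|^p for all t ≥ 0. -/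
/-- A differentiable function with nonnegative derivative on `[0, b]` that vanishes at `0` is
nonnegative at `b`. -/
theorem nonneg_of_hasDerivAt_nonneg {g g' : ℝ → ℝ} {b : ℝ} (hb : 0 ≤ b) (h0 : g 0 = 0)
    (hg : ∀ x, HasDerivAt g (g' x) x) (hg' : ∀ x, 0 ≤ x → x ≤ b → 0 ≤ g' x) : 0 ≤ g b := by
  have hmono : MonotoneOn g (Set.Icc 0 b) :=
    monotoneOn_of_hasDerivWithinAt_nonneg (convex_Icc 0 b)
      (fun x _ => (hg x).continuousAt.continuousWithinAt)
      (fun x _ => (hg x).hasDerivWithinAt)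
      (fun x hx => by
        rw [interior_Icc] at hx
        exact hg' x hx.1.le hx.2.le)
  simpa [h0] using hmono (Set.left_mem_Icc.2 hb) (Set.right_mem_Icc.2 hb) hb

/-- The superquadratic inequality for `t ↦ t ^ p` at a point `s + x` to the right of `s`. -/
theorem rpow_add_mul_add_rpow_le {p s x : ℝ} (hp : 2 ≤ p) (hs : 0 ≤ s) (hx : 0 ≤ x) :
    s ^ p + p * s ^ (p - 1) * x + x ^ p ≤ (s + x) ^ p := by
  have hg (y : ℝ) : HasDerivAt (fun y : ℝ => (s + y) ^ p - s ^ p - p * s ^ (p - 1) * y - y ^ p)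
      (p * ((s + y) ^ (p - 1) - s ^ (p - 1) - y ^ (p - 1))) y := by
    have h1 : 1 ≤ p := by linarith
    refine HasDerivAt.congr_deriv
      ((((((hasDerivAt_id y).const_add s).rpow_const (Or.inr h1)).sub_const (s ^ p)).sub
        ((hasDerivAt_id y).const_mul (p * s ^ (p - 1)))).sub
        (Real.hasDerivAt_rpow_const (Or.inr h1))) ?_
    simp only [id]
    ring
  have h0 : (s + 0) ^ p - s ^ p - p * s ^ (p - 1) * 0 - (0 : ℝ) ^ p = 0 := by
    simp [Real.zero_rpow (by linarith : p ≠ 0)]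
  have := nonneg_of_hasDerivAt_nonneg hx h0 hg fun y hy _ =>
    mul_nonneg (by linarith)
      (by linarith [Real.add_rpow_le_rpow_add hs hy (by linarith : 1 ≤ p - 1)])
  linarith

/-- The superquadratic inequality for `t ↦ t ^ p` at a point `s - x` to the left of `s`. -/
theorem rpow_sub_mul_add_rpow_le {p s x : ℝ} (hp : 2 ≤ p) (hx : 0 ≤ x) (hxs : x ≤ s) :
    s ^ p - p * s ^ (p - 1) * x + x ^ p ≤ (s - x) ^ p := by
  have hg (y : ℝ) : HasDerivAt (fun y : ℝ => (s - y) ^ p - s ^ p + p * s ^ (p - 1) * y - y ^ p)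
      (p * (s ^ (p - 1) - (s - y) ^ (p - 1) - y ^ (p - 1))) y := by
    have h1 : 1 ≤ p := by linarith
    refine HasDerivAt.congr_deriv
      ((((((hasDerivAt_id y).const_sub s).rpow_const (Or.inr h1)).sub_const (s ^ p)).add
        ((hasDerivAt_id y).const_mul (p * s ^ (p - 1)))).sub
        (Real.hasDerivAt_rpow_const (Or.inr h1))) ?_
    simp only [id]
    ring
  have h0 : (s - 0) ^ p - s ^ p + p * s ^ (p - 1) * 0 - (0 : ℝ) ^ p = 0 := by
    simp [Real.zero_rpow (by linarith : p ≠ 0)]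
  have := nonneg_of_hasDerivAt_nonneg hx h0 hg fun y hy hyx => by
    have h := Real.add_rpow_le_rpow_add (sub_nonneg.2 (hyx.trans hxs)) hy
      (by linarith : 1 ≤ p - 1)
    rw [sub_add_cancel] at h
    exact mul_nonneg (by linarith) (by linarith)
  linarith

/-- For every real `p ≥ 2`, the power function `t ↦ t ^ p` is superquadratic on `[0,∞)`;
moreover the constant can be taken to be `C_s = p·s^(p-1)`:
`t^p ≥ s^p + p·s^(p-1)·(t - s) + |t - s|^p` for all `s, t ≥ 0`. -/
theorem rpow_superquadratic (p : ℝ) (hp : 2 ≤ p) :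
    Superquadratic (fun t : ℝ => t ^ p) ∧
      ∀ s : ℝ, 0 ≤ s → ∀ t : ℝ, 0 ≤ t →
        s ^ p + p * s ^ (p - 1) * (t - s) + |t - s| ^ p ≤ t ^ p := by
  have key : ∀ s : ℝ, 0 ≤ s → ∀ t : ℝ, 0 ≤ t →
      s ^ p + p * s ^ (p - 1) * (t - s) + |t - s| ^ p ≤ t ^ p := by
    intro s hs t ht
    rcases le_total s t with h | h
    · rw [abs_of_nonneg (sub_nonneg.2 h)]
      simpa using rpow_add_mul_add_rpow_le hp hs (sub_nonneg.2 h)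
    · rw [abs_of_nonpos (sub_nonpos.2 h), neg_sub]
      have := rpow_sub_mul_add_rpow_le hp (sub_nonneg.2 h) (sub_le_self s ht)
      rw [sub_sub_cancel] at this
      linarith
  exact ⟨fun s hs => ⟨p * s ^ (p - 1), key s hs⟩, key⟩
end

section
/- For every real p with 1 ≤ p ≤ 2, the function f(t) = −t^p is superquadratic on [0,∞); that is, for every s ≥ 0 there exists C_s ∈ ℝ such that −t^p ≥ −s^p + C_s(t − s) − |t − s|^p for all t ≥ 0. -/
/-- The tangent-line bound for `x ↦ x ^ p`, `1 ≤ p ≤ 2`, to the right of the base point. -/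
theorem Real.add_rpow_le_add_mul_add_rpow {p a b : ℝ} (hp1 : 1 ≤ p) (hp2 : p ≤ 2)
    (ha : 0 ≤ a) (hb : 0 ≤ b) :
    (a + b) ^ p ≤ a ^ p + p * a ^ (p - 1) * b + b ^ p := by
  have hd (x : ℝ) : HasDerivAt (fun u : ℝ => p * a ^ (p - 1) * u + u ^ p - (a + u) ^ p)
      (p * a ^ (p - 1) + p * x ^ (p - 1) - p * (a + x) ^ (p - 1)) x := by
    refine HasDerivAt.congr_deriv ((((hasDerivAt_id x).const_mul (p * a ^ (p - 1))).add
      (Real.hasDerivAt_rpow_const (x := x) (Or.inr hp1))).sub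
      (((hasDerivAt_id x).const_add a).rpow_const (Or.inr hp1))) ?_
    simp only [id]
    ring
  have hmono : MonotoneOn (fun u : ℝ => p * a ^ (p - 1) * u + u ^ p - (a + u) ^ p)
      (Set.Ici 0) := by
    refine monotoneOn_of_hasDerivWithinAt_nonneg (convex_Ici 0)
      (fun x _ => (hd x).continuousAt.continuousWithinAt)
      (fun x _ => (hd x).hasDerivWithinAt) fun x hx => ?_
    have hx0 : 0 ≤ x := interior_subset hx
    have := Real.rpow_add_le_add_rpow ha hx0 (p := p - 1) (by linarith) (by linarith)
    nlinarith
  have h := hmono (Set.mem_Ici.2 le_rfl) (Set.mem_Ici.2 hb) hb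
  simp only [mul_zero, add_zero, Real.zero_rpow (by linarith : p ≠ 0)] at h
  linarith

/-- The tangent-line bound for `x ↦ x ^ p`, `1 ≤ p ≤ 2`, to the left of the base point. -/
theorem Real.rpow_add_mul_le_add_rpow_add_rpow {p a b : ℝ} (hp1 : 1 ≤ p) (hp2 : p ≤ 2)
    (ha : 0 ≤ a) (hb : 0 ≤ b) :
    a ^ p + p * (a + b) ^ (p - 1) * b ≤ (a + b) ^ p + b ^ p := by
  set s := a + b with hs
  have hd (x : ℝ) : HasDerivAt (fun u : ℝ => u ^ p - p * s ^ (p - 1) * u - (s - u) ^ p)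
      (p * x ^ (p - 1) - p * s ^ (p - 1) + p * (s - x) ^ (p - 1)) x := by
    refine HasDerivAt.congr_deriv (((Real.hasDerivAt_rpow_const (x := x) (Or.inr hp1)).sub
      ((hasDerivAt_id x).const_mul (p * s ^ (p - 1)))).sub
      (((hasDerivAt_id x).const_sub s).rpow_const (Or.inr hp1))) ?_
    simp only [id]
    ring
  have hmono : MonotoneOn (fun u : ℝ => u ^ p - p * s ^ (p - 1) * u - (s - u) ^ p)
      (Set.Icc 0 s) := by
    refine monotoneOn_of_hasDerivWithinAt_nonneg (convex_Icc 0 s)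
      (fun x _ => (hd x).continuousAt.continuousWithinAt)
      (fun x _ => (hd x).hasDerivWithinAt) fun x hx => ?_
    have hx0 : x ∈ Set.Icc 0 s := interior_subset hx
    have := Real.rpow_add_le_add_rpow hx0.1 (sub_nonneg.2 hx0.2) (p := p - 1)
      (by linarith) (by linarith)
    rw [add_sub_cancel] at this
    nlinarith
  have h := hmono (a := 0) (b := b) ⟨le_rfl, by linarith⟩ ⟨hb, by linarith⟩ hb
  simp only [mul_zero, sub_zero, Real.zero_rpow (by linarith : p ≠ 0)] at h
  rw [show s - b = a by linarith] at h
  linarith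

/-- For every real `1 ≤ p ≤ 2`, the function `t ↦ -t ^ p` is superquadratic on `[0,∞)`:
for every `s ≥ 0` there is `C ∈ ℝ` with `-t^p ≥ -s^p + C(t - s) - |t - s|^p` for all
`t ≥ 0`. -/
theorem neg_rpow_superquadratic (p : ℝ) (hp1 : 1 ≤ p) (hp2 : p ≤ 2) :
    Superquadratic (fun t : ℝ => -(t ^ p)) := by
  intro s hs
  refine ⟨-(p * s ^ (p - 1)), fun t ht => ?_⟩
  dsimp only
  rcases le_total s t with hst | hts
  · have h := Real.add_rpow_le_add_mul_add_rpow hp1 hp2 hs (sub_nonneg.2 hst)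
    rw [add_sub_cancel] at h
    rw [abs_of_nonneg (sub_nonneg.2 hst)]
    linarith
  · have h := Real.rpow_add_mul_le_add_rpow_add_rpow hp1 hp2 ht (sub_nonneg.2 hts)
    rw [add_sub_cancel] at h
    rw [abs_sub_comm, abs_of_nonneg (sub_nonneg.2 hts)]
    linarith
end
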